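/- Let (A,+,·) be a left brace with A^{(3)} = {0} and let a ∈ A. Define a_1 = a and a_{j+1} = a*a_j for j ≥ 1. Then for every positive integer n and every j ≥ 1, (n·a)*a_j = ∑_{k=1}^n C(n,k)·a_{k+j}, where n·a is the n-fold additive multiple of a and C(n,k) is the binomial coefficient. -/

import Mathlib

/-- `λ_a(b) = -a + a·b` for a left-brace multiplication `mul`. -/
def braceLam {A : Type*} [AddCommGroup A] (mul : A → A → A) (a b : A) : A :=
  -a + mul a b

/-- The star operation `a * b = λ_a(b) - b`. -/
def braceStar {A : Type*} [AddCommGroup A] (mul : A → A → A) (a b : A) : A :=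
  braceLam mul a b - b

/-- `rightSeries mul r` is `A^{(r+1)}` of the paper: `rightSeries mul 0 = A^{(1)} = A` and
`rightSeries mul (r+1) = A^{(r+2)} = A^{(r+1)} * A`, the additive subgroup generated by
star products of elements of `A^{(r+1)}` with elements of `A`. -/
def rightSeries {A : Type*} [AddCommGroup A] (mul : A → A → A) : ℕ → AddSubgroup A
  | 0 => ⊤
  | r + 1 => AddSubgroup.closure {x | ∃ z c, z ∈ rightSeries mul r ∧ x = braceStar mul z c}

section Brace

variable {A : Type*} [AddCommGroup A] {mul : A → A → A}

theorem braceLam_eq_star_add (mul : A → A → A) (a b : A) :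
    braceLam mul a b = braceStar mul a b + b := by
  simp [braceStar]

theorem mul_eq_add_braceLam (mul : A → A → A) (a b : A) : mul a b = a + braceLam mul a b := by
  simp [braceLam]

theorem braceLam_add (hdist : ∀ a b c : A, mul a (b + c) = mul a b - a + mul a c) (a b c : A) :
    braceLam mul a (b + c) = braceLam mul a b + braceLam mul a c := by
  simp only [braceLam, hdist]
  abel

/-- `λ_{a·b} = λ_a ∘ λ_b`. -/
theorem braceLam_mul (hassoc : ∀ a b c : A, mul (mul a b) c = mul a (mul b c))
    (hdist : ∀ a b c : A, mul a (b + c) = mul a b - a + mul a c) (a b c : A) :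
    braceLam mul (mul a b) c = braceLam mul a (braceLam mul b c) := by
  have h : mul a (mul b c) = mul a b - a + mul a (braceLam mul b c) := by
    rw [← hdist, ← mul_eq_add_braceLam]
  rw [braceLam, hassoc, h, braceLam.eq_def mul a]
  abel

theorem braceStar_mem_rightSeries_one (mul : A → A → A) (a b : A) :
    braceStar mul a b ∈ rightSeries mul 1 :=
  AddSubgroup.subset_closure ⟨a, b, AddSubgroup.mem_top a, rfl⟩

theorem braceLam_mem_rightSeries_one (a : A) {z : A} (hz : z ∈ rightSeries mul 1) :
    braceLam mul a z ∈ rightSeries mul 1 := by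
  rw [braceLam_eq_star_add]
  exact add_mem (braceStar_mem_rightSeries_one mul a z) hz

/-- If `A^{(3)} = 0`, then `A^{(2)}` acts trivially. -/
theorem braceLam_of_mem_rightSeries_one (h3 : rightSeries mul 2 = ⊥) {z : A}
    (hz : z ∈ rightSeries mul 1) (c : A) : braceLam mul z c = c := by
  have h : braceStar mul z c ∈ rightSeries mul 2 := AddSubgroup.subset_closure ⟨z, c, hz, rfl⟩
  rw [h3, AddSubgroup.mem_bot] at h
  rw [braceLam_eq_star_add, h, zero_add]

/-- If `A^{(3)} = 0`, then `λ_x` depends only on `x` modulo `A^{(2)}`. -/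
theorem braceLam_add_of_mem_rightSeries_one
    (hassoc : ∀ a b c : A, mul (mul a b) c = mul a (mul b c))
    (hzl : ∀ a : A, mul 0 a = a)
    (hinv : ∀ a : A, ∃ b : A, mul a b = 0 ∧ mul b a = 0)
    (hdist : ∀ a b c : A, mul a (b + c) = mul a b - a + mul a c)
    (h3 : rightSeries mul 2 = ⊥) (x : A) {z : A} (hz : z ∈ rightSeries mul 1) (c : A) :
    braceLam mul (x + z) c = braceLam mul x c := by
  obtain ⟨y, hxy, -⟩ := hinv x
  have hz' : braceLam mul x (braceLam mul y z) = z := by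
    rw [← braceLam_mul hassoc hdist, hxy, braceLam, hzl, neg_zero, zero_add]
  have hxz : x + z = mul x (braceLam mul y z) := by
    rw [mul_eq_add_braceLam mul, hz']
  rw [hxz, braceLam_mul hassoc hdist,
    braceLam_of_mem_rightSeries_one h3 (braceLam_mem_rightSeries_one y hz)]

/-- If `A^{(3)} = 0`, then `λ_{x+y} = λ_x ∘ λ_y`. -/
theorem braceLam_add_left
    (hassoc : ∀ a b c : A, mul (mul a b) c = mul a (mul b c))
    (hzl : ∀ a : A, mul 0 a = a)
    (hinv : ∀ a : A, ∃ b : A, mul a b = 0 ∧ mul b a = 0)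
    (hdist : ∀ a b c : A, mul a (b + c) = mul a b - a + mul a c)
    (h3 : rightSeries mul 2 = ⊥) (x y c : A) :
    braceLam mul (x + y) c = braceLam mul x (braceLam mul y c) := by
  have hxy : mul x y = x + y + braceStar mul x y := by
    rw [mul_eq_add_braceLam mul, braceLam_eq_star_add]
    abel
  rw [← braceLam_mul hassoc hdist, hxy, braceLam_add_of_mem_rightSeries_one hassoc hzl hinv
    hdist h3 _ (braceStar_mem_rightSeries_one mul x y)]

/-- If `A^{(3)} = 0`, then `λ_{n·a} = (1 + (a * ·))^n`, evaluated on the iterates of `a * ·`. -/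
theorem braceLam_nsmul
    (hassoc : ∀ a b c : A, mul (mul a b) c = mul a (mul b c))
    (hzl : ∀ a : A, mul 0 a = a)
    (hinv : ∀ a : A, ∃ b : A, mul a b = 0 ∧ mul b a = 0)
    (hdist : ∀ a b c : A, mul a (b + c) = mul a b - a + mul a c)
    (h3 : rightSeries mul 2 = ⊥) (a : A) (f : ℕ → A)
    (hf : ∀ j : ℕ, 1 ≤ j → f (j + 1) = braceStar mul a (f j)) (n j : ℕ) (hj : 1 ≤ j) :
    braceLam mul (n • a) (f j) = ∑ k ∈ Finset.range (n + 1), n.choose k • f (k + j) := by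
  induction n generalizing j with
  | zero => simp [braceLam, hzl]
  | succ n ih =>
    rw [succ_nsmul, braceLam_add_left hassoc hzl hinv hdist h3, braceLam_eq_star_add mul a,
      ← hf j hj, braceLam_add hdist, ih (j + 1) (by omega), ih j hj,
      Finset.sum_range_succ' _ (n + 1)]
    simp only [Nat.choose_succ_succ', add_smul, Finset.sum_add_distrib]
    rw [Finset.sum_range_succ (fun k => n.choose (k + 1) • f (k + 1 + j)),
      Finset.sum_range_succ' (fun k => n.choose k • f (k + j))]
    simp [add_assoc, add_comm 1 j]

end Brace

/-- Let `A` be a left brace with `A^{(3)} = {0}` and `a ∈ A`.  With `a_1 = a`,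
`a_{j+1} = a * a_j`, one has `(n·a) * a_j = ∑_{k=1}^n C(n,k)·a_{k+j}` for every positive
integer `n` and every `j ≥ 1`, where `n·a` is the `n`-fold additive multiple of `a`. -/
theorem stmt11 {A : Type*} [AddCommGroup A]
    (mul : A → A → A)
    (hassoc : ∀ a b c : A, mul (mul a b) c = mul a (mul b c))
    (hzl : ∀ a : A, mul 0 a = a)
    (hzr : ∀ a : A, mul a 0 = a)
    (hinv : ∀ a : A, ∃ b : A, mul a b = 0 ∧ mul b a = 0)
    (hdist : ∀ a b c : A, mul a (b + c) = mul a b - a + mul a c)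
    (h3 : rightSeries mul 2 = ⊥)
    (a : A) (f : ℕ → A) (hf1 : f 1 = a)
    (hf : ∀ j : ℕ, 1 ≤ j → f (j + 1) = braceStar mul a (f j)) :
    ∀ n : ℕ, 1 ≤ n → ∀ j : ℕ, 1 ≤ j →
      braceStar mul (n • a) (f j) = ∑ k ∈ Finset.Icc 1 n, (n.choose k : ℤ) • f (k + j) := by
  intro n _ j hj
  rw [braceStar, braceLam_nsmul hassoc hzl hinv hdist h3 a f hf n j hj,
    Finset.sum_range_succ', ← Finset.Ico_add_one_right_eq_Icc, Finset.sum_Ico_eq_sum_range]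
  simp [add_comm 1]
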